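/- Let S be a finite set with |S| = m ≥ 4 in a metric space (M,d), and let π : [m] → S be a uniformly random bijection. Then Σ over distinct i,j ∈ [⌊m/2⌋] of E[d(π(2i−1),π(2i))·d(π(2j−1),π(2j))] ≤ ⌊m/2⌋·(⌊m/2⌋−1)·(1/(m(m−1)(m−2)(m−3)))·(Σ_{u,v∈S} d(u,v))². -/

import Mathlib

theorem emb_avg {α : Type*} [Fintype α] [DecidableEq α] (F : α → α → α → α → ℝ)
    (hF : ∀ a b c e, 0 ≤ F a b c e) (m : ℕ) (hm : Fintype.card α = m)
    (p : Fin 4 ↪ Fin m) :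
    (m.descFactorial 4 : ℝ) * ∑ π : Fin m ≃ α, F (π (p 0)) (π (p 1)) (π (p 2)) (π (p 3)) ≤
      (Fintype.card (Fin m ≃ α) : ℝ) * ∑ a, ∑ b, ∑ c, ∑ e, F a b c e := by
  have key : ∀ q : Fin 4 ↪ Fin m,
      ∑ π : Fin m ≃ α, F (π (q 0)) (π (q 1)) (π (q 2)) (π (q 3)) =
      ∑ π : Fin m ≃ α, F (π (p 0)) (π (p 1)) (π (p 2)) (π (p 3)) := by
    intro q
    obtain ⟨σ, hσ⟩ := (Equiv.Perm.isMultiplyPretransitive (Fin m) 4).exists_smul_eq p q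
    have h : ∀ k, q k = σ (p k) := by
      intro k; rw [← hσ]; rfl
    simp only [h]
    exact Fintype.sum_equiv (Equiv.equivCongr σ (Equiv.refl α)).symm _ _ (fun π => rfl)
  have h1 : (m.descFactorial 4 : ℝ) *
      ∑ π : Fin m ≃ α, F (π (p 0)) (π (p 1)) (π (p 2)) (π (p 3)) =
      ∑ q : Fin 4 ↪ Fin m, ∑ π : Fin m ≃ α, F (π (q 0)) (π (q 1)) (π (q 2)) (π (q 3)) := by
    rw [Finset.sum_congr rfl (fun q _ => key q)]
    simp [Fintype.card_embedding_eq]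
  rw [h1, Finset.sum_comm]
  have h2 : ∀ π ∈ (Finset.univ : Finset (Fin m ≃ α)),
      ∑ q : Fin 4 ↪ Fin m, F (π (q 0)) (π (q 1)) (π (q 2)) (π (q 3)) ≤
        ∑ a, ∑ b, ∑ c, ∑ e, F a b c e := by
    intro π _
    let φ : (Fin 4 ↪ Fin m) ↪ α × α × α × α :=
      ⟨fun q => (π (q 0), π (q 1), π (q 2), π (q 3)), by
        intro q r h
        simp only [Prod.mk.injEq, EmbeddingLike.apply_eq_iff_eq] at h
        ext k
        fin_cases k <;> simp [h]⟩
    have h3 : ∑ a, ∑ b, ∑ c, ∑ e, F a b c e =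
        ∑ x : α × α × α × α, F x.1 x.2.1 x.2.2.1 x.2.2.2 := by
      simp only [Fintype.sum_prod_type]
    rw [h3]
    have h4 := Finset.sum_map (Finset.univ) φ (fun x => F x.1 x.2.1 x.2.2.1 x.2.2.2)
    refine le_trans (le_of_eq h4.symm) ?_
    exact Finset.sum_le_sum_of_subset_of_nonneg (Finset.subset_univ _) (fun x _ _ => hF _ _ _ _)
  refine (Finset.sum_le_sum h2).trans (le_of_eq ?_)
  simp

theorem stmt_9 {α : Type*} [Fintype α] [DecidableEq α] (d : α → α → ℝ)
    (h0 : ∀ x y, d x y = 0 ↔ x = y)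
    (hsymm : ∀ x y, d x y = d y x)
    (htri : ∀ x y z, d x z ≤ d x y + d y z)
    (hnonneg : ∀ x y, 0 ≤ d x y)
    (m : ℕ) (hm : Fintype.card α = m) (hm4 : 4 ≤ m) :
    ∑ i ∈ (Finset.range (m / 2)).attach, ∑ j ∈ (Finset.range (m / 2)).attach,
        (if i ≠ j then
          (∑ π : Fin m ≃ α,
              d (π ⟨2 * i.1, by have := Finset.mem_range.mp i.2; omega⟩)
                  (π ⟨2 * i.1 + 1, by have := Finset.mem_range.mp i.2; omega⟩) *
                d (π ⟨2 * j.1, by have := Finset.mem_range.mp j.2; omega⟩)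
                  (π ⟨2 * j.1 + 1, by have := Finset.mem_range.mp j.2; omega⟩)) /
            (Fintype.card (Fin m ≃ α) : ℝ)
        else 0) ≤
      ((m / 2 : ℕ) : ℝ) * (((m / 2 : ℕ) : ℝ) - 1) *
        (1 / ((m : ℝ) * ((m : ℝ) - 1) * ((m : ℝ) - 2) * ((m : ℝ) - 3))) *
        (∑ u, ∑ v, d u v) ^ 2 := by
  set D : ℝ := (∑ u, ∑ v, d u v) ^ 2 with hD
  set C : ℝ := 1 / ((m : ℝ) * ((m : ℝ) - 1) * ((m : ℝ) - 2) * ((m : ℝ) - 3)) with hC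
  have hm4' : (4 : ℝ) ≤ m := by exact_mod_cast hm4
  have hdesc : (m.descFactorial 4 : ℝ) = (m : ℝ) * ((m : ℝ) - 1) * ((m : ℝ) - 2) * ((m : ℝ) - 3) := by
    obtain ⟨k, rfl⟩ := Nat.exists_eq_add_of_le hm4
    simp only [Nat.descFactorial, Nat.sub_zero]
    rw [show 4 + k - 3 = k + 1 by omega, show 4 + k - 2 = k + 2 by omega,
      show 4 + k - 1 = k + 3 by omega]
    push_cast
    ring
  have hpos : (0 : ℝ) < m.descFactorial 4 := by
    exact_mod_cast Nat.descFactorial_pos.mpr hm4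
  have hcard : (0 : ℝ) < Fintype.card (Fin m ≃ α) := by
    have : Nonempty (Fin m ≃ α) := ⟨(Fintype.equivFinOfCardEq hm).symm⟩
    exact_mod_cast Fintype.card_pos
  have hsum : ∑ a, ∑ b, ∑ c, ∑ e, d a b * d c e = D := by
    rw [hD, sq]
    simp only [Finset.sum_mul, Finset.mul_sum]
    simp only [mul_comm]
  have main : ∀ a b c e : Fin m, a ≠ b → a ≠ c → a ≠ e → b ≠ c → b ≠ e → c ≠ e →
      (∑ π : Fin m ≃ α, d (π a) (π b) * d (π c) (π e)) / (Fintype.card (Fin m ≃ α) : ℝ) ≤ C * D := by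
    intro a b c e hab hac hae hbc hbe hce
    have hinj : Function.Injective ![a, b, c, e] := by
      intro i j h
      fin_cases i <;> fin_cases j <;> simp_all [eq_comm]
    have := emb_avg (fun a b c e => d a b * d c e)
      (fun a b c e => mul_nonneg (hnonneg _ _) (hnonneg _ _)) m hm ⟨![a, b, c, e], hinj⟩
    rw [hsum] at this
    simp only [Function.Embedding.coeFn_mk, Matrix.cons_val] at this
    rw [hC, ← hdesc, div_le_iff₀ hcard, one_div, mul_assoc, ← div_eq_inv_mul, le_div_iff₀ hpos]
    linarith
  have bound : ∀ i ∈ (Finset.range (m / 2)).attach, ∀ j ∈ (Finset.range (m / 2)).attach,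
        (if i ≠ j then
          (∑ π : Fin m ≃ α,
              d (π ⟨2 * i.1, by have := Finset.mem_range.mp i.2; omega⟩)
                  (π ⟨2 * i.1 + 1, by have := Finset.mem_range.mp i.2; omega⟩) *
                d (π ⟨2 * j.1, by have := Finset.mem_range.mp j.2; omega⟩)
                  (π ⟨2 * j.1 + 1, by have := Finset.mem_range.mp j.2; omega⟩)) /
            (Fintype.card (Fin m ≃ α) : ℝ)
        else 0) ≤ C * D - (if i = j then C * D else 0) := by
    intro i _ j _
    by_cases hij : i = j
    · simp [hij]
    · have hij' : i.1 ≠ j.1 := fun h => hij (Subtype.ext h)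
      rw [if_pos hij, if_neg hij, sub_zero]
      apply main <;> (simp only [ne_eq, Fin.mk.injEq]; omega)
  refine (Finset.sum_le_sum fun i hi => Finset.sum_le_sum (bound i hi)).trans (le_of_eq ?_)
  simp only [Finset.sum_sub_distrib, Finset.sum_ite_eq, Finset.mem_attach, if_true,
    Finset.sum_const, Finset.card_attach, Finset.card_range, nsmul_eq_mul]
  ring
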